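/- Under the parameter choices, suppose the coefficient bounds of the key proposition hold at iteration t. Then for all r ∈ [m], j ∈ {±1}, i ∈ [n] with j = y_i: (i) ⟨w_{j,r}^{(t)}, y_i·v⟩ = ⟨w_{j,r}^{(0)}, y_i·v⟩ + Γ_{j,r}^{(t)} − η Σ_{s=1}^t ⟨z_s, y_i·v⟩; (ii) ⟨w_{j,r}^{(t)}, ξ_i⟩ ≤ ⟨w_{j,r}^{(0)}, ξ_i⟩ + Φ̄_{j,r,i}^{(t)} + 8n√(log(4n²/δ)/d)·α − η Σ_{s=1}^t ⟨z_s, ξ_i⟩. Moreover, if max{Φ̄_{j,r,i}^{(t)}, Γ_{j,r}^{(t)}} = O(1), then F_j(W_j^{(t)}, x_i) = O(1); quantitatively, F_j(W_j^{(t)}, x_i) ≤ 2·5^q·max_{j,r,i}{|⟨w_{j,r}^{(0)}, v⟩|, |⟨w_{j,r}^{(0)}, ξ_i⟩|, 8n√(log(4n²/δ)/d)·α, η·C·T_p*·μ·log(1/δ)·(‖v‖₂+‖ξ‖₂)/(mnε), Γ_{j,r}^{(t)}, Φ̄_{j,r,i}^{(t)}}^q. -/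

import Mathlib

open MeasureTheory ProbabilityTheory Finset
open scoped RealInnerProductSpace BigOperators ENNReal NNReal

noncomputable section

/-- Euclidean space ℝ^d. -/
abbrev EV (d : ℕ) : Type := EuclideanSpace ℝ (Fin d)

/-- Polynomial ReLU activation σ(z) = max(0,z)^q. -/
def pReLU (q : ℕ) (z : ℝ) : ℝ := (max 0 z) ^ q

/-- Derivative σ'(z) = q·max(0,z)^(q-1). -/
def pReLU' (q : ℕ) (z : ℝ) : ℝ := q * (max 0 z) ^ (q - 1)

/-- Sign associated to a filter-group index: j = 0 ↦ +1, j = 1 ↦ -1. -/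
def jsgn (j : Fin 2) : ℝ := if j = 0 then 1 else -1

/-- Output F_j of group j of the two-layer CNN on the two-patch input (x1, x2). -/
def Fout {d : ℕ} (q m : ℕ) (W : Fin 2 → Fin m → EV d) (j : Fin 2) (x1 x2 : EV d) : ℝ :=
  (m : ℝ)⁻¹ * ∑ r : Fin m, (pReLU q ⟪W j r, x1⟫ + pReLU q ⟪W j r, x2⟫)

/-- CNN output f(W,x) = F₊(W₊,x) − F₋(W₋,x). -/
def fnet {d : ℕ} (q m : ℕ) (W : Fin 2 → Fin m → EV d) (x1 x2 : EV d) : ℝ :=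
  Fout q m W 0 x1 x2 - Fout q m W 1 x1 x2

/-- Logistic loss ℓ(z) = log(1+exp(−z)). -/
def logloss (z : ℝ) : ℝ := Real.log (1 + Real.exp (-z))

/-- Its derivative ℓ'(z) = −1/(1+exp z). -/
def logloss' (z : ℝ) : ℝ := -(1 / (1 + Real.exp z))

/-- Empirical logistic loss on the training data x_i = [y_i • v, ξ_i]. -/
def empLoss {d : ℕ} (q m n : ℕ) (y : Fin n → ℝ) (v : EV d) (ξ : Fin n → EV d)
    (W : Fin 2 → Fin m → EV d) : ℝ :=
  (n : ℝ)⁻¹ * ∑ i : Fin n, logloss (y i * fnet q m W (y i • v) (ξ i))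

/-- Gradient of the empirical loss with respect to filter w_{j,r}. -/
def gradFilter {d : ℕ} (q m n : ℕ) (y : Fin n → ℝ) (v : EV d) (ξ : Fin n → EV d)
    (W : Fin 2 → Fin m → EV d) (j : Fin 2) (r : Fin m) : EV d :=
  ((n : ℝ) * (m : ℝ))⁻¹ •
    ((∑ i : Fin n, (logloss' (y i * fnet q m W (y i • v) (ξ i)) *
        pReLU' q ⟪W j r, ξ i⟫ * (jsgn j * y i)) • ξ i)
    + (∑ i : Fin n, (logloss' (y i * fnet q m W (y i • v) (ξ i)) *
        pReLU' q ⟪W j r, y i • v⟫ * jsgn j) • v))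

/-- Gradient of the network output f(W, x) with respect to filter w_{j,r}. -/
def gradfFilter {d : ℕ} (q m : ℕ) (W : Fin 2 → Fin m → EV d) (x1 x2 : EV d)
    (j : Fin 2) (r : Fin m) : EV d :=
  ((m : ℝ)⁻¹ * jsgn j) • (pReLU' q ⟪W j r, x1⟫ • x1 + pReLU' q ⟪W j r, x2⟫ • x2)

/-- Frobenius inner product of two weight configurations. -/
def frobInner {d m : ℕ} (A B : Fin 2 → Fin m → EV d) : ℝ :=
  ∑ j : Fin 2, ∑ r : Fin m, ⟪A j r, B j r⟫

/-- Squared Frobenius norm of a weight configuration. -/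
def frobSq {d m : ℕ} (A : Fin 2 → Fin m → EV d) : ℝ :=
  ∑ j : Fin 2, ∑ r : Fin m, ‖A j r‖ ^ 2

/-- A random vector `g` is centered Gaussian with covariance quadratic form `Q`:
every one-dimensional projection ⟪g, u⟫ has law N(0, Q u). -/
def IsGaussianVec {Ω : Type*} [MeasureSpace Ω] {d : ℕ} (g : Ω → EV d) (Q : EV d → ℝ) : Prop :=
  Measurable g ∧ ∀ u : EV d,
    Measure.map (fun ω => ⟪g ω, u⟫) (ℙ : Measure Ω) =
      ProbabilityTheory.gaussianReal 0 (Real.toNNReal (Q u))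

/-- Over finite index types, every value of a real family is at most its triple supremum. -/
theorem le_ciSup_triple {ι κ τ : Type*} [Finite ι] [Finite κ] [Finite τ]
    (f : ι → κ → τ → ℝ) (a : ι) (b : κ) (c : τ) :
    f a b c ≤ ⨆ (a' : ι) (b' : κ) (c' : τ), f a' b' c' :=
  (le_ciSup (Set.finite_range fun c' => f a b c').bddAbove c).trans
    ((le_ciSup (Set.finite_range fun b' => ⨆ c', f a b' c').bddAbove b).trans
      (le_ciSup (Set.finite_range fun a' => ⨆ b', ⨆ c', f a' b' c').bddAbove a))

theorem jsgn_sq (j : Fin 2) : jsgn j * jsgn j = 1 := by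
  unfold jsgn; split_ifs <;> norm_num

theorem abs_jsgn (j : Fin 2) : |jsgn j| = 1 := by
  unfold jsgn; split_ifs <;> norm_num

theorem jsgn_ne_neg (j : Fin 2) : jsgn j ≠ -jsgn j := by
  unfold jsgn; split_ifs <;> norm_num

theorem pReLU_le_pow {q : ℕ} {x b : ℝ} (hb : 0 ≤ b) (hx : x ≤ b) : pReLU q x ≤ b ^ q :=
  pow_le_pow_left₀ (le_max_left _ _) (max_le hb hx) q

/-- If both activations of every filter are bounded by `b`, then `F_j` is bounded by `2 b^q`. -/
theorem Fout_le {d q m : ℕ} (hm : 0 < m) (W : Fin 2 → Fin m → EV d) (j : Fin 2)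
    (x1 x2 : EV d) {b : ℝ} (hb : 0 ≤ b) (h1 : ∀ r, ⟪W j r, x1⟫ ≤ b)
    (h2 : ∀ r, ⟪W j r, x2⟫ ≤ b) : Fout q m W j x1 x2 ≤ 2 * b ^ q := by
  have hm' : (0 : ℝ) < m := by exact_mod_cast hm
  have hsum : ∑ r : Fin m, (pReLU q ⟪W j r, x1⟫ + pReLU q ⟪W j r, x2⟫)
      ≤ ∑ _r : Fin m, 2 * b ^ q :=
    Finset.sum_le_sum fun r _ => by
      linarith [pReLU_le_pow (q := q) hb (h1 r), pReLU_le_pow (q := q) hb (h2 r)]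
  rw [Finset.sum_const, Finset.card_univ, Fintype.card_fin, nsmul_eq_mul] at hsum
  unfold Fout
  rw [inv_mul_le_iff₀ hm']
  exact hsum

/-- A combination of nearly orthogonal long vectors, normalized by their squared lengths and with
coefficients bounded by `α`, has inner product with the `i`-th vector close to its `i`-th
coefficient. -/
theorem sum_normalized_inner_le {d n : ℕ} (hd : 0 < d) {α σ L : ℝ} (hσ : 0 < σ)
    (hα : 0 ≤ α) (ξ : Fin n → EV d) (c : Fin n → ℝ) (hc : ∀ i, |c i| ≤ α)
    (hnorm : ∀ i, σ ^ 2 * d / 2 ≤ ‖ξ i‖ ^ 2)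
    (hcross : ∀ i i', i ≠ i' → |⟪ξ i', ξ i⟫| ≤ 2 * σ ^ 2 * Real.sqrt (d * L)) (i : Fin n) :
    ∑ k : Fin n, c k / ‖ξ k‖ ^ 2 * ⟪ξ k, ξ i⟫ ≤ c i + 8 * n * Real.sqrt (L / d) * α := by
  have hd' : (0 : ℝ) < d := by exact_mod_cast hd
  have hpos : 0 < σ ^ 2 * d / 2 := by positivity
  have hsqrt : Real.sqrt (d * L) = d * Real.sqrt (L / d) := by
    rw [show (d : ℝ) * L = (d : ℝ) ^ 2 * (L / d) by field_simp,
      Real.sqrt_mul (by positivity), Real.sqrt_sq hd'.le]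
  have hs : 0 ≤ Real.sqrt (L / d) := Real.sqrt_nonneg _
  have hterm : ∀ k, c k / ‖ξ k‖ ^ 2 * ⟪ξ k, ξ i⟫
      ≤ (if k = i then c i else 0) + 4 * Real.sqrt (L / d) * α := by
    intro k
    have hk : 0 < ‖ξ k‖ ^ 2 := hpos.trans_le (hnorm k)
    split_ifs with h
    · subst h
      rw [real_inner_self_eq_norm_sq, div_mul_cancel₀ _ hk.ne']
      have : 0 ≤ 4 * Real.sqrt (L / d) * α := by positivity
      linarith
    · rw [zero_add]
      refine (le_abs_self _).trans ?_
      rw [abs_mul, abs_div, abs_of_pos hk, div_mul_eq_mul_div, div_le_iff₀ hk]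
      calc |c k| * |⟪ξ k, ξ i⟫|
          ≤ α * (2 * σ ^ 2 * Real.sqrt (d * L)) :=
            mul_le_mul (hc k) (hcross i k (Ne.symm h)) (abs_nonneg _) hα
        _ = 4 * Real.sqrt (L / d) * α * (σ ^ 2 * d / 2) := by rw [hsqrt]; ring
        _ ≤ 4 * Real.sqrt (L / d) * α * ‖ξ k‖ ^ 2 :=
            mul_le_mul_of_nonneg_left (hnorm k) (by positivity)
  refine (Finset.sum_le_sum fun k _ => hterm k).trans ?_
  rw [Finset.sum_add_distrib, Finset.sum_ite_eq' Finset.univ i fun _ => c i,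
    if_pos (Finset.mem_univ i), Finset.sum_const, Finset.card_univ, Fintype.card_fin,
    nsmul_eq_mul]
  have : 0 ≤ (n : ℝ) * Real.sqrt (L / d) * α := by positivity
  linarith

/-- **Lemma C.6 / lem:F_1.** Under the parameter choices and the coefficient
bounds of the key proposition at iteration `t`, for every `r, j, i` with `j = y_i`:
(i) `⟨w_{j,r}^{(t)}, y_i v⟩ = ⟨w_{j,r}^{(0)}, y_i v⟩ + Γ_{j,r}^{(t)} − η Σ_s ⟨z_s, y_i v⟩`;
(ii) `⟨w_{j,r}^{(t)}, ξ_i⟩ ≤ ⟨w_{j,r}^{(0)}, ξ_i⟩ + Φ̄_{j,r,i}^{(t)} + 8n√(log(4n²/δ)/d)·α − η Σ_s ⟨z_s, ξ_i⟩`;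
and moreover `F_j(W_j^{(t)}, x_i)` is bounded by `2·5^q·M^q` where `M` is the maximum of all
listed quantities (so if `max{Φ̄, Γ} = O(1)` then `F_j(W_j^{(t)}, x_i) = O(1)`). -/
theorem statement9
    (d q m n : ℕ) (hq : 2 < q) (hd : 0 < d) (hm : 0 < m) (hn : 0 < n)
    (η α δ σξ C Tp μ ε nrmξ : ℝ)
    (hη : 0 < η) (hδ0 : 0 < δ) (hδ1 : δ < 1) (hσξ : 0 < σξ) (hα : 0 ≤ α)
    (hC : 0 < C) (hTp : 0 < Tp) (hμ : 1 ≤ μ) (hε : 0 < ε) (hnξ : 0 < nrmξ)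
    (v : EV d) (hv : v ≠ 0) (ξ : Fin n → EV d) (y : Fin n → ℝ)
    (hy : ∀ i, y i = 1 ∨ y i = -1)
    (horth : ∀ i, ⟪ξ i, v⟫ = 0)
    (z : ℕ → EV d) (W : ℕ → Fin 2 → Fin m → EV d) (t : ℕ)
    (Γ : Fin 2 → Fin m → ℝ) (Φb Φu : Fin 2 → Fin m → Fin n → ℝ)
    (hΦb : ∀ j r i, 0 ≤ Φb j r i ∧ (y i ≠ jsgn j → Φb j r i = 0))
    (hΦu : ∀ j r i, Φu j r i ≤ 0 ∧ (y i ≠ -jsgn j → Φu j r i = 0))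
    (hΓα : ∀ j r, 0 ≤ Γ j r ∧ Γ j r ≤ α)
    (hΦbα : ∀ j r i, Φb j r i ≤ α)
    (hΦuα : ∀ j r i, -α ≤ Φu j r i)
    (hnorm : ∀ i, σξ ^ 2 * d / 2 ≤ ‖ξ i‖ ^ 2)
    (hcross : ∀ i i', i ≠ i' →
      |⟪ξ i', ξ i⟫| ≤ 2 * σξ ^ 2 * Real.sqrt (d * Real.log (4 * n ^ 2 / δ)))
    (hdecomp : ∀ j r, W t j r = W 0 j r + ((jsgn j * Γ j r) / ‖v‖ ^ 2) • v
        + ∑ i : Fin n, ((Φb j r i + Φu j r i) / ‖ξ i‖ ^ 2) • ξ i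
        - η • ∑ s ∈ Finset.Icc 1 t, z s)
    (hzv : |η * ∑ s ∈ Finset.Icc 1 t, ⟪z s, v⟫|
      ≤ η * C * Tp * μ * Real.log (1 / δ) * (‖v‖ + nrmξ) / (m * n * ε))
    (hzξ : ∀ i, |η * ∑ s ∈ Finset.Icc 1 t, ⟪z s, ξ i⟫|
      ≤ η * C * Tp * μ * Real.log (1 / δ) * (‖v‖ + nrmξ) / (m * n * ε))
    (hsmall :
      4 * max
        (2 * ⨆ (j : Fin 2) (r : Fin m) (i : Fin n),
            max |⟪W 0 j r, v⟫| |⟪W 0 j r, ξ i⟫|)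
        (max (8 * n * Real.sqrt (Real.log (4 * n ^ 2 / δ) / d) * α)
          (η * C * Tp * μ * Real.log (1 / δ) * (‖v‖ + nrmξ) / (m * n * ε))) ≤ 1) :
    ∀ (j : Fin 2) (r : Fin m) (i : Fin n), y i = jsgn j →
      (⟪W t j r, y i • v⟫
          = ⟪W 0 j r, y i • v⟫ + Γ j r - η * ∑ s ∈ Finset.Icc 1 t, ⟪z s, y i • v⟫) ∧
      (⟪W t j r, ξ i⟫
          ≤ ⟪W 0 j r, ξ i⟫ + Φb j r i
            + 8 * n * Real.sqrt (Real.log (4 * n ^ 2 / δ) / d) * α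
            - η * ∑ s ∈ Finset.Icc 1 t, ⟪z s, ξ i⟫) ∧
      Fout q m (W t) j (y i • v) (ξ i)
        ≤ 2 * 5 ^ q *
          (max
            (⨆ (j' : Fin 2) (r' : Fin m) (i' : Fin n),
              max |⟪W 0 j' r', v⟫| |⟪W 0 j' r', ξ i'⟫|)
            (max
              (max (8 * n * Real.sqrt (Real.log (4 * n ^ 2 / δ) / d) * α)
                (η * C * Tp * μ * Real.log (1 / δ) * (‖v‖ + nrmξ) / (m * n * ε)))
              (⨆ (j' : Fin 2) (r' : Fin m) (i' : Fin n),
                max (Γ j' r') (Φb j' r' i')))) ^ q := by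
  intro j r i hij
  have hcoef : ∀ r k, |Φb j r k + Φu j r k| ≤ α := by
    intro r k
    have hb := hΦb j r k
    have hu := hΦu j r k
    by_cases h : y k = jsgn j
    · rw [hu.2 (by rw [h]; exact jsgn_ne_neg j), add_zero, abs_of_nonneg hb.1]
      exact hΦbα j r k
    · rw [hb.2 h, zero_add, abs_of_nonpos hu.1]
      linarith [hΦuα j r k]
  have hv2 : ‖v‖ ^ 2 ≠ 0 := pow_ne_zero 2 (norm_ne_zero_iff.2 hv)
  have hsignal : ∀ r, ⟪W t j r, y i • v⟫
      = ⟪W 0 j r, y i • v⟫ + Γ j r - η * ∑ s ∈ Finset.Icc 1 t, ⟪z s, y i • v⟫ := by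
    intro r
    rw [hdecomp j r]
    simp only [inner_sub_left, inner_add_left, sum_inner, real_inner_smul_left,
      real_inner_smul_right, horth, mul_zero, Finset.sum_const_zero, real_inner_self_eq_norm_sq]
    rw [div_mul_cancel₀ _ hv2, ← Finset.mul_sum, hij]
    linear_combination Γ j r * jsgn_sq j
  have hnoise : ∀ r, ⟪W t j r, ξ i⟫
      ≤ ⟪W 0 j r, ξ i⟫ + Φb j r i + 8 * n * Real.sqrt (Real.log (4 * n ^ 2 / δ) / d) * α
        - η * ∑ s ∈ Finset.Icc 1 t, ⟪z s, ξ i⟫ := by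
    intro r
    have hΦu0 : Φu j r i = 0 := (hΦu j r i).2 (by rw [hij]; exact jsgn_ne_neg j)
    have hvξ : ⟪v, ξ i⟫ = 0 := by rw [real_inner_comm]; exact horth i
    have hsum := sum_normalized_inner_le hd hσξ hα ξ (fun k => Φb j r k + Φu j r k)
      (hcoef r) hnorm hcross i
    rw [hdecomp j r]
    simp only [inner_sub_left, inner_add_left, sum_inner, real_inner_smul_left, hvξ, mul_zero]
    linarith
  refine ⟨hsignal r, hnoise r, ?_⟩
  set A := ⨆ (j' : Fin 2) (r' : Fin m) (i' : Fin n), max |⟪W 0 j' r', v⟫| |⟪W 0 j' r', ξ i'⟫|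
  set G := ⨆ (j' : Fin 2) (r' : Fin m) (i' : Fin n), max (Γ j' r') (Φb j' r' i')
  set B := 8 * n * Real.sqrt (Real.log (4 * n ^ 2 / δ) / d) * α
  set N := η * C * Tp * μ * Real.log (1 / δ) * (‖v‖ + nrmξ) / (m * n * ε)
  set M := max A (max (max B N) G)
  have hinit : ∀ r, max |⟪W 0 j r, v⟫| |⟪W 0 j r, ξ i⟫| ≤ M := fun r =>
    (le_ciSup_triple (fun j' r' i' => max |⟪W 0 j' r', v⟫| |⟪W 0 j' r', ξ i'⟫|) j r i).trans
      (le_max_left _ _)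
  have hlearn : ∀ r, max (Γ j r) (Φb j r i) ≤ M := fun r =>
    (le_ciSup_triple (fun j' r' i' => max (Γ j' r') (Φb j' r' i')) j r i).trans
      ((le_max_right _ _).trans (le_max_right _ _))
  have hBM : B ≤ M := (le_max_left _ _).trans ((le_max_left _ _).trans (le_max_right _ _))
  have hNM : N ≤ M := (le_max_right _ _).trans ((le_max_left _ _).trans (le_max_right _ _))
  have hM0 : 0 ≤ M := (abs_nonneg _).trans ((le_max_left _ _).trans (hinit r))
  have hyv : ∀ x : ℝ, -(y i * x) ≤ |x| ∧ y i * x ≤ |x| := by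
    intro x
    rw [hij, ← one_mul |x|, ← abs_jsgn j, ← abs_mul]
    exact ⟨neg_le_abs _, le_abs_self _⟩
  have hbound := Fout_le (q := q) hm (W t) j (y i • v) (ξ i) (b := 5 * M) (by positivity)
    (fun r => by
      rw [hsignal r]
      simp only [real_inner_smul_right, ← Finset.mul_sum]
      have h1 := (hyv ⟪W 0 j r, v⟫).2
      have h2 := (hyv (η * ∑ s ∈ Finset.Icc 1 t, ⟪z s, v⟫)).1
      have h3 := (max_le_iff.1 (hinit r)).1
      have h4 := (max_le_iff.1 (hlearn r)).1
      linarith)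
    (fun r => by
      have h1 := le_abs_self ⟪W 0 j r, ξ i⟫
      have h2 := neg_le_abs (η * ∑ s ∈ Finset.Icc 1 t, ⟪z s, ξ i⟫)
      have h3 := (max_le_iff.1 (hinit r)).2
      have h4 := (max_le_iff.1 (hlearn r)).2
      linarith [hnoise r, hzξ i])
  rwa [mul_pow, ← mul_assoc] at hbound
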